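/- Let w1, w2 be even integers ≥ 2. The sequence 0 → V_{w1−1,w2−1}^ℚ[I_D] → V_{w1,w2}^ℚ[I_D] → W_{w1+w2}^ℚ → 0 is exact, where the first map is μ : P(X1,X2) ↦ (X1−X2)·P(X1,X2) and the second is diagonal evaluation ψ : P(X1,X2) ↦ P(Z,Z). That is: μ is well defined (its image satisfies the diagonal relations) and injective, the image of μ equals the kernel of ψ, and ψ is surjective onto W_{w1+w2}^ℚ. -/

import Mathlib

open MvPolynomial

/-- `SL(2, ℤ)`. -/
abbrev SL2Z := Matrix.SpecialLinearGroup (Fin 2) ℤ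

/-- `S = [[0,-1],[1,0]]`. -/
def matS : SL2Z := ⟨!![0, -1; 1, 0], by norm_num [Matrix.det_fin_two_of]⟩

/-- `U = [[0,1],[-1,1]]`. -/
def matU : SL2Z := ⟨!![0, 1; -1, 1], by norm_num [Matrix.det_fin_two_of]⟩

/-- `T = [[1,1],[0,1]]`. -/
def matT : SL2Z := ⟨!![1, 1; 0, 1], by norm_num [Matrix.det_fin_two_of]⟩

/-- The weight-`w` action of `γ = [[a,b],[c,d]] ∈ SL(2,ℤ)` on a one-variable polynomial of
degree ≤ w : `(γ·Q)(X) = (-cX+a)^w Q((dX-b)/(-cX+a))`, written coefficientwise. -/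
noncomputable def polyAct1 {R : Type*} [CommRing R] (w : ℕ) (γ : SL2Z) (Q : Polynomial R) :
    Polynomial R :=
  ∑ m ∈ Finset.range (w + 1),
    Polynomial.C (Q.coeff m) *
      (Polynomial.C ((γ.1 1 1 : ℤ) : R) * Polynomial.X - Polynomial.C ((γ.1 0 1 : ℤ) : R)) ^ m *
      (Polynomial.C (-((γ.1 1 0 : ℤ) : R)) * Polynomial.X + Polynomial.C ((γ.1 0 0 : ℤ) : R)) ^
        (w - m)

/-- `((dX-b)^m) * ((-cX+a)^n)` for `γ = [[a,b],[c,d]]`, in the variable `x`. -/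
noncomputable def mfrac {R : Type*} [CommRing R] (γ : SL2Z) (x : MvPolynomial (Fin 2) R)
    (m n : ℕ) : MvPolynomial (Fin 2) R :=
  (MvPolynomial.C ((γ.1 1 1 : ℤ) : R) * x - MvPolynomial.C ((γ.1 0 1 : ℤ) : R)) ^ m *
    (MvPolynomial.C (-((γ.1 1 0 : ℤ) : R)) * x + MvPolynomial.C ((γ.1 0 0 : ℤ) : R)) ^ n

/-- The action of a pair `(γ1, γ2) ∈ SL(2,ℤ)²` on polynomials in `X1 = X 0`, `X2 = X 1` of
degree ≤ w1 in `X1` and ≤ w2 in `X2`: the weight-`w1` action on `X1` via `γ1` and the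
weight-`w2` action on `X2` via `γ2`. -/
noncomputable def polyAct2 {R : Type*} [CommRing R] (w1 w2 : ℕ) (γ1 γ2 : SL2Z)
    (P : MvPolynomial (Fin 2) R) : MvPolynomial (Fin 2) R :=
  ∑ m1 ∈ Finset.range (w1 + 1), ∑ m2 ∈ Finset.range (w2 + 1),
    MvPolynomial.C (MvPolynomial.coeff (Finsupp.single 0 m1 + Finsupp.single 1 m2) P) *
      mfrac γ1 (MvPolynomial.X 0) m1 (w1 - m1) * mfrac γ2 (MvPolynomial.X 1) m2 (w2 - m2)

/-- Membership in `V_w^ℚ` : degree at most `w`. -/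
def MemV1 (w : ℕ) (P : Polynomial ℚ) : Prop := P.natDegree ≤ w

/-- Membership in `W_w^ℚ = {P ∈ V_w^ℚ : (1+S)·P = 0, (1+U+U²)·P = 0}`. -/
def MemW1 (w : ℕ) (P : Polynomial ℚ) : Prop :=
  MemV1 w P ∧ P + polyAct1 w matS P = 0 ∧
    P + polyAct1 w matU P + polyAct1 w (matU ^ 2) P = 0

/-- Membership in `V_{w1,w2}^ℚ` : degree ≤ w1 in `X1 = X 0` and ≤ w2 in `X2 = X 1`. -/
def MemV2 (w1 w2 : ℕ) (P : MvPolynomial (Fin 2) ℚ) : Prop :=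
  MvPolynomial.degreeOf 0 P ≤ w1 ∧ MvPolynomial.degreeOf 1 P ≤ w2

/-- The embedding `P1(X) ↦ P1(X1)` of one-variable polynomials in the variable `X1 = X 0`. -/
noncomputable def toX1 (P1 : Polynomial ℚ) : MvPolynomial (Fin 2) ℚ :=
  Polynomial.aeval (MvPolynomial.X 0 : MvPolynomial (Fin 2) ℚ) P1


/-- The embedding `P2(X) ↦ P2(X2)` of one-variable polynomials in the variable `X2 = X 1`. -/
noncomputable def toX2 (P2 : Polynomial ℚ) : MvPolynomial (Fin 2) ℚ :=
  Polynomial.aeval (MvPolynomial.X 1 : MvPolynomial (Fin 2) ℚ) P2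

/-- Membership in `V_{w1,w2}^ℚ[I_D]` : lies in `V_{w1,w2}^ℚ` and is killed by
`(1,1)+(S,S)` and `(1,1)+(U,U)+(U²,U²)`. -/
def MemVID (w1 w2 : ℕ) (P : MvPolynomial (Fin 2) ℚ) : Prop :=
  MemV2 w1 w2 P ∧ P + polyAct2 w1 w2 matS matS P = 0 ∧
    P + polyAct2 w1 w2 matU matU P + polyAct2 w1 w2 (matU ^ 2) (matU ^ 2) P = 0

/-- Diagonal evaluation `P(X1,X2) ↦ P(Z,Z)`. -/
noncomputable def diagEval (P : MvPolynomial (Fin 2) ℚ) : Polynomial ℚ :=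
  MvPolynomial.aeval (fun _ : Fin 2 => (Polynomial.X : Polynomial ℚ)) P

/-- Multiplication by `X1 - X2`, the first map of the exact sequence. -/
noncomputable def mulDiag (P : MvPolynomial (Fin 2) ℚ) : MvPolynomial (Fin 2) ℚ :=
  (MvPolynomial.X 0 - MvPolynomial.X 1) * P

noncomputable def act1L (w : ℕ) (γ : SL2Z) : Polynomial ℚ →ₗ[ℚ] Polynomial ℚ where
  toFun := polyAct1 w γ
  map_add' p q := by
    simp only [polyAct1, Polynomial.coeff_add, Polynomial.C_add, add_mul, Finset.sum_add_distrib]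
  map_smul' c p := by
    rw [RingHom.id_apply, Polynomial.smul_eq_C_mul, Polynomial.smul_eq_C_mul]
    simp only [polyAct1, Polynomial.coeff_C_mul, Polynomial.C_mul, mul_assoc,
      ← Finset.mul_sum]

noncomputable def act2L (w1 w2 : ℕ) (γ1 γ2 : SL2Z) :
    MvPolynomial (Fin 2) ℚ →ₗ[ℚ] MvPolynomial (Fin 2) ℚ where
  toFun := polyAct2 w1 w2 γ1 γ2
  map_add' p q := by
    simp only [polyAct2, MvPolynomial.coeff_add, MvPolynomial.C_add, add_mul,
      Finset.sum_add_distrib]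
  map_smul' c p := by
    rw [RingHom.id_apply, MvPolynomial.smul_eq_C_mul, MvPolynomial.smul_eq_C_mul]
    simp only [polyAct2, MvPolynomial.coeff_C_mul, MvPolynomial.C_mul, mul_assoc,
      ← Finset.mul_sum]

theorem act1L_apply (w : ℕ) (γ : SL2Z) (Q : Polynomial ℚ) :
    act1L w γ Q = polyAct1 w γ Q := rfl

theorem act2L_apply (w1 w2 : ℕ) (γ1 γ2 : SL2Z) (P : MvPolynomial (Fin 2) ℚ) :
    act2L w1 w2 γ1 γ2 P = polyAct2 w1 w2 γ1 γ2 P := rfl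

noncomputable def diagL : MvPolynomial (Fin 2) ℚ →ₗ[ℚ] Polynomial ℚ :=
  (MvPolynomial.aeval (fun _ : Fin 2 => (Polynomial.X : Polynomial ℚ))).toLinearMap

noncomputable def mulL : MvPolynomial (Fin 2) ℚ →ₗ[ℚ] MvPolynomial (Fin 2) ℚ :=
  LinearMap.mulLeft ℚ (MvPolynomial.X 0 - MvPolynomial.X 1)

noncomputable def sigL (w1 w2 : ℕ) : Polynomial ℚ →ₗ[ℚ] MvPolynomial (Fin 2) ℚ where
  toFun Q := ∑ i ∈ Finset.range (w1 + 1), ∑ j ∈ Finset.range (w2 + 1),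
    MvPolynomial.C (Q.coeff (i + j)) *
      (MvPolynomial.C ((w1.choose i : ℚ) * (w2.choose j : ℚ) / ((w1 + w2).choose (i + j) : ℚ)) *
        (MvPolynomial.X 0 ^ i * MvPolynomial.X 1 ^ j))
  map_add' p q := by
    simp only [Polynomial.coeff_add, MvPolynomial.C_add, add_mul, Finset.sum_add_distrib]
  map_smul' c p := by
    simp only [Polynomial.coeff_smul, smul_eq_mul, MvPolynomial.C_mul, mul_assoc,
      ← Finset.mul_sum, MvPolynomial.smul_eq_C_mul, RingHom.id_apply]

theorem sigL_apply (w1 w2 : ℕ) (Q : Polynomial ℚ) : sigL w1 w2 Q =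
    ∑ i ∈ Finset.range (w1 + 1), ∑ j ∈ Finset.range (w2 + 1),
    MvPolynomial.C (Q.coeff (i + j)) *
      (MvPolynomial.C ((w1.choose i : ℚ) * (w2.choose j : ℚ) / ((w1 + w2).choose (i + j) : ℚ)) *
        (MvPolynomial.X 0 ^ i * MvPolynomial.X 1 ^ j)) := rfl

theorem mono_eq (i j : ℕ) :
    (X 0 ^ i * X 1 ^ j : MvPolynomial (Fin 2) ℚ) =
      monomial (Finsupp.single 0 i + Finsupp.single 1 j) 1 := by
  rw [X_pow_eq_monomial, X_pow_eq_monomial, monomial_mul, one_mul]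

theorem single_inj2 (i j m n : ℕ) :
    ((Finsupp.single 0 i + Finsupp.single 1 j : Fin 2 →₀ ℕ) =
      Finsupp.single 0 m + Finsupp.single 1 n) ↔ (i = m ∧ j = n) := by
  constructor
  · intro h
    have h0 := DFunLike.congr_fun h 0
    have h1 := DFunLike.congr_fun h 1
    simp at h0 h1
    exact ⟨h0, h1⟩
  · rintro ⟨rfl, rfl⟩; rfl

theorem act2_mono (w1 w2 : ℕ) (γ1 γ2 : SL2Z) (i j : ℕ) (hi : i ≤ w1) (hj : j ≤ w2) :
    polyAct2 w1 w2 γ1 γ2 (X 0 ^ i * X 1 ^ j : MvPolynomial (Fin 2) ℚ) =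
      mfrac γ1 (X 0) i (w1 - i) * mfrac γ2 (X 1) j (w2 - j) := by
  unfold polyAct2
  rw [Finset.sum_eq_single i, Finset.sum_eq_single j]
  · rw [mono_eq, coeff_monomial, if_pos rfl, C_1, one_mul]
  · intro b _ hb
    rw [mono_eq, coeff_monomial, if_neg (by rw [single_inj2]; tauto), C_0, zero_mul, zero_mul]
  · intro h; simp at h; omega
  · intro b _ hb
    refine Finset.sum_eq_zero fun k _ => ?_
    rw [mono_eq, coeff_monomial, if_neg (by rw [single_inj2]; tauto), C_0, zero_mul, zero_mul]
  · intro h; simp at h; omega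

theorem ext2 {M : Type*} [AddCommGroup M] [Module ℚ M] (w1 w2 : ℕ)
    (F G : MvPolynomial (Fin 2) ℚ →ₗ[ℚ] M)
    (h : ∀ i j, i ≤ w1 → j ≤ w2 → F (X 0 ^ i * X 1 ^ j) = G (X 0 ^ i * X 1 ^ j))
    (P : MvPolynomial (Fin 2) ℚ) (hP : MemV2 w1 w2 P) : F P = G P := by
  rw [P.as_sum, map_sum, map_sum]
  refine Finset.sum_congr rfl fun v hv => ?_
  have h0 := degreeOf_le_iff.1 hP.1 v hv
  have h1 := degreeOf_le_iff.1 hP.2 v hv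
  have hv : v = Finsupp.single 0 (v 0) + Finsupp.single 1 (v 1) := by
    ext k; fin_cases k <;> simp
  have : monomial v (coeff v P) = (coeff v P) • (X 0 ^ (v 0) * X 1 ^ (v 1)) := by
    rw [mono_eq, ← hv, smul_monomial, smul_eq_mul, mul_one]
  rw [this, map_smul, map_smul, h _ _ h0 h1]

theorem act2_mul (a b : ℕ) (γ : SL2Z) (P : MvPolynomial (Fin 2) ℚ) (hP : MemV2 a b P) :
    polyAct2 (a + 1) (b + 1) γ γ (mulDiag P) = mulDiag (polyAct2 a b γ γ P) := by
  refine ext2 a b ((act2L (a + 1) (b + 1) γ γ).comp mulL) (mulL.comp (act2L a b γ γ)) ?_ P hP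
  intro i j hi hj
  have e : mulL (X 0 ^ i * X 1 ^ j) = X 0 ^ (i + 1) * X 1 ^ j - X 0 ^ i * X 1 ^ (j + 1) := by
    simp only [mulL, LinearMap.mulLeft_apply]; ring
  rw [LinearMap.comp_apply, LinearMap.comp_apply, e, map_sub]
  simp only [mulL, LinearMap.mulLeft_apply, act2L_apply]
  rw [act2_mono _ _ _ _ _ _ (by omega) (by omega), act2_mono _ _ _ _ _ _ (by omega) (by omega),
    act2_mono _ _ _ _ _ _ hi hj]
  have hd : (C (((γ.1 0 0 : ℤ) : ℚ)) * C (((γ.1 1 1 : ℤ) : ℚ)) -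
      C (((γ.1 0 1 : ℤ) : ℚ)) * C (((γ.1 1 0 : ℤ) : ℚ)) : MvPolynomial (Fin 2) ℚ) = 1 := by
    rw [← C_mul, ← C_mul, ← C_sub, ← C_1]
    congr 1
    have := γ.2
    rw [Matrix.det_fin_two] at this
    exact_mod_cast this
  unfold mfrac
  rw [show a + 1 - (i + 1) = a - i by omega, show b + 1 - (j + 1) = b - j by omega,
    show a + 1 - i = (a - i) + 1 by omega, show b + 1 - j = (b - j) + 1 by omega]
  simp only [pow_succ, C_neg]
  generalize (C (((γ.1 0 0 : ℤ) : ℚ)) : MvPolynomial (Fin 2) ℚ) = p at *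
  generalize (C (((γ.1 0 1 : ℤ) : ℚ)) : MvPolynomial (Fin 2) ℚ) = q at *
  generalize (C (((γ.1 1 0 : ℤ) : ℚ)) : MvPolynomial (Fin 2) ℚ) = r at *
  generalize (C (((γ.1 1 1 : ℤ) : ℚ)) : MvPolynomial (Fin 2) ℚ) = s at *
  generalize (s * X 0 - q) ^ i = A
  generalize (s * X 1 - q) ^ j = B
  generalize (-r * X 0 + p) ^ (a - i) = D
  generalize (-r * X 1 + p) ^ (b - j) = E
  linear_combination (A * B * D * E * (X 0 - X 1)) * hd

theorem act1_mono (w : ℕ) (γ : SL2Z) (i : ℕ) (hi : i ≤ w) :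
    polyAct1 w γ (Polynomial.X ^ i : Polynomial ℚ) =
      (Polynomial.C ((γ.1 1 1 : ℤ) : ℚ) * Polynomial.X - Polynomial.C ((γ.1 0 1 : ℤ) : ℚ)) ^ i *
      (Polynomial.C (-((γ.1 1 0 : ℤ) : ℚ)) * Polynomial.X + Polynomial.C ((γ.1 0 0 : ℤ) : ℚ)) ^
        (w - i) := by
  unfold polyAct1
  rw [Finset.sum_eq_single i]
  · rw [Polynomial.coeff_X_pow, if_pos rfl, Polynomial.C_1, one_mul]
  · intro b _ hb
    rw [Polynomial.coeff_X_pow, if_neg hb, Polynomial.C_0, zero_mul, zero_mul]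
  · intro h; simp at h; omega

theorem diag_act (a b : ℕ) (γ : SL2Z) (P : MvPolynomial (Fin 2) ℚ) (hP : MemV2 a b P) :
    diagEval (polyAct2 a b γ γ P) = polyAct1 (a + b) γ (diagEval P) := by
  refine ext2 a b (diagL.comp (act2L a b γ γ)) ((act1L (a + b) γ).comp diagL) ?_ P hP
  intro i j hi hj
  have e : diagL (X 0 ^ i * X 1 ^ j) = Polynomial.X ^ (i + j) := by
    simp [diagL, pow_add]
  rw [LinearMap.comp_apply, LinearMap.comp_apply, e]
  simp only [act1L_apply, act2L_apply]
  rw [act2_mono _ _ _ _ _ _ hi hj, act1_mono _ _ _ (by omega),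
    show a + b - (i + j) = (a - i) + (b - j) by omega]
  simp only [diagL, mfrac, AlgHom.toLinearMap_apply, map_mul, map_pow, map_sub, map_add, aeval_X,
    MvPolynomial.algHom_C, Polynomial.algebraMap_eq]
  ring

theorem diag_deg (a b : ℕ) (P : MvPolynomial (Fin 2) ℚ) (hP : MemV2 a b P) :
    (diagEval P).natDegree ≤ a + b := by
  unfold diagEval
  rw [P.as_sum, map_sum]
  refine Polynomial.natDegree_sum_le_of_forall_le _ _ fun v hv => ?_
  have h0 := degreeOf_le_iff.1 hP.1 v hv
  have h1 := degreeOf_le_iff.1 hP.2 v hv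
  rw [aeval_monomial, Finsupp.prod_fintype _ _ (by simp), Fin.prod_univ_two, ← pow_add,
    Polynomial.algebraMap_eq]
  exact (Polynomial.natDegree_C_mul_X_pow_le _ _).trans (by omega)

theorem X01_ne : (X 0 - X 1 : MvPolynomial (Fin 2) ℚ) ≠ 0 := by
  intro h
  have := congrArg (MvPolynomial.eval (fun k : Fin 2 => if k = 0 then (1 : ℚ) else 0)) h
  simp at this

theorem mulDiag_inj (P P' : MvPolynomial (Fin 2) ℚ) (h : mulDiag P = mulDiag P') : P = P' :=
  mul_left_cancel₀ X01_ne h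

theorem coeff_X01 (k : Fin 2) : Finsupp.single k 1 ∈ (X 0 - X 1 : MvPolynomial (Fin 2) ℚ).support := by
  rw [mem_support_iff]
  fin_cases k <;> simp [coeff_X, Finsupp.single_left_inj]

theorem deg_X01 (k : Fin 2) : degreeOf k (X 0 - X 1 : MvPolynomial (Fin 2) ℚ) = 1 := by
  apply le_antisymm
  · refine (degreeOf_sub_le _ _ _).trans ?_
    fin_cases k <;> simp [degreeOf_X]
  · have := degreeOf_le_iff.1 (le_refl (degreeOf k (X 0 - X 1 : MvPolynomial (Fin 2) ℚ))) _
      (coeff_X01 k)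
    simpa using this

theorem memV2_mul (a b : ℕ) (P : MvPolynomial (Fin 2) ℚ) :
    MemV2 (a + 1) (b + 1) (mulDiag P) ↔ MemV2 a b P := by
  by_cases hP : P = 0
  · subst hP; simp [mulDiag, MemV2]
  · unfold MemV2 mulDiag
    rw [degreeOf_mul_eq X01_ne hP, degreeOf_mul_eq X01_ne hP, deg_X01, deg_X01]
    omega

theorem memVID_mul (a b : ℕ) (P : MvPolynomial (Fin 2) ℚ) :
    MemVID (a + 1) (b + 1) (mulDiag P) ↔ MemVID a b P := by
  unfold MemVID
  rw [memV2_mul]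
  refine and_congr_right fun hP => ?_
  rw [act2_mul _ _ _ _ hP, act2_mul _ _ _ _ hP, act2_mul _ _ _ _ hP]
  unfold mulDiag
  rw [← mul_add, ← mul_add, ← mul_add, mul_eq_zero, mul_eq_zero]
  simp [X01_ne]

theorem diag_mul (P : MvPolynomial (Fin 2) ℚ) : diagEval (mulDiag P) = 0 := by
  simp [diagEval, mulDiag]

theorem diag_ker (P : MvPolynomial (Fin 2) ℚ) (h : diagEval P = 0) : ∃ P0, P = mulDiag P0 := by
  let I : Ideal (MvPolynomial (Fin 2) ℚ) := Ideal.span {X 0 - X 1}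
  have key : (Ideal.Quotient.mkₐ ℚ I) =
      (Polynomial.aeval (Ideal.Quotient.mkₐ ℚ I (X 1))).comp
        (MvPolynomial.aeval (fun _ : Fin 2 => (Polynomial.X : Polynomial ℚ))) := by
    apply MvPolynomial.algHom_ext
    intro k
    rw [AlgHom.comp_apply, aeval_X, Polynomial.aeval_X]
    fin_cases k
    · exact Ideal.Quotient.eq.2 (Ideal.subset_span rfl)
    · rfl
  have h2 := congrArg (fun f => f P) key
  simp only [AlgHom.comp_apply] at h2
  have h3 : MvPolynomial.aeval (fun _ : Fin 2 => (Polynomial.X : Polynomial ℚ)) P = 0 := h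
  rw [h3, map_zero] at h2
  have h4 : P ∈ I := Ideal.Quotient.eq_zero_iff_mem.1 h2
  obtain ⟨c, hc⟩ := Ideal.mem_span_singleton.1 h4
  exact ⟨c, hc⟩

theorem coeff_lin (p q : ℚ) (n k : ℕ) :
    ((Polynomial.C p * Polynomial.X + Polynomial.C q) ^ n).coeff k =
      p ^ k * q ^ (n - k) * (n.choose k : ℚ) := by
  rw [add_pow, Polynomial.finsetSum_coeff]
  have : ∀ m ∈ Finset.range (n + 1), ((Polynomial.C p * Polynomial.X) ^ m * Polynomial.C q ^ (n - m)
      * ((n.choose m : ℕ) : Polynomial ℚ)).coeff k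
      = if k = m then p ^ m * q ^ (n - m) * (n.choose m : ℚ) else 0 := by
    intro m _
    have : (Polynomial.C p * Polynomial.X) ^ m * Polynomial.C q ^ (n - m)
      * ((n.choose m : ℕ) : Polynomial ℚ) =
      Polynomial.C (p ^ m * q ^ (n - m) * (n.choose m : ℚ)) * Polynomial.X ^ m := by
      simp only [Polynomial.C_mul, Polynomial.C_pow, map_natCast]; ring
    rw [this, Polynomial.coeff_C_mul_X_pow]
  rw [Finset.sum_congr rfl this, Finset.sum_ite_eq]
  split_ifs with hk
  · rfl
  · simp at hk
    rw [Nat.choose_eq_zero_of_lt (by omega)]; simp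

theorem ext1 {M : Type*} [AddCommGroup M] [Module ℚ M] (n : ℕ)
    (F G : Polynomial ℚ →ₗ[ℚ] M)
    (h : ∀ α : ℚ, F ((Polynomial.C α * Polynomial.X + Polynomial.C 1) ^ n) =
      G ((Polynomial.C α * Polynomial.X + Polynomial.C 1) ^ n))
    (Q : Polynomial ℚ) (hQ : Q.natDegree ≤ n) : F Q = G Q := by
  let N : Submodule ℚ (Polynomial ℚ) := LinearMap.ker (F - G)
  suffices hN : Q ∈ N by
    have : (F - G) Q = 0 := hN
    rwa [LinearMap.sub_apply, sub_eq_zero] at this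
  by_contra hc
  obtain ⟨f, hf, hle⟩ := Submodule.exists_le_ker_of_notMem hc
  apply hf
  have hz : ∀ α : ℚ, f ((Polynomial.C α * Polynomial.X + Polynomial.C 1) ^ n) = 0 := by
    intro α
    apply hle
    change (F - G) _ = 0
    rw [LinearMap.sub_apply, h, sub_self]
  let p : Polynomial ℚ := ∑ k ∈ Finset.range (n + 1),
    Polynomial.C ((n.choose k : ℚ) * f (Polynomial.X ^ k)) * Polynomial.X ^ k
  have hp : p = 0 := by
    apply Polynomial.funext
    intro α
    rw [Polynomial.eval_zero, ← hz α, Polynomial.as_sum_range' ((Polynomial.C α * Polynomial.X + Polynomial.C 1) ^ n) (n + 1)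
      (Nat.lt_succ_of_le ((Polynomial.natDegree_pow_le_of_le n
        (Polynomial.natDegree_linear_le)).trans (by omega))), map_sum, Polynomial.eval_finsetSum]
    refine Finset.sum_congr rfl fun k _ => ?_
    rw [coeff_lin, ← Polynomial.C_mul_X_pow_eq_monomial,
      ← Polynomial.smul_eq_C_mul (α ^ k * 1 ^ (n - k) * (n.choose k : ℚ)), map_smul]
    simp
    ring
  have hk : ∀ k ≤ n, f (Polynomial.X ^ k) = 0 := by
    intro k hk
    have h1 : p.coeff k = 0 := by rw [hp, Polynomial.coeff_zero]
    simp only [p, Polynomial.finsetSum_coeff, Polynomial.coeff_C_mul_X_pow,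
      Finset.sum_ite_eq, Finset.mem_range, Nat.lt_succ_of_le hk, if_true] at h1
    rcases mul_eq_zero.1 h1 with h2 | h2
    · exact absurd h2 (by exact_mod_cast (Nat.choose_pos hk).ne')
    · exact h2
  rw [Polynomial.as_sum_range' Q (n + 1) (Nat.lt_succ_of_le hQ), map_sum]
  refine Finset.sum_eq_zero fun k hk' => ?_
  rw [← Polynomial.C_mul_X_pow_eq_monomial, ← Polynomial.smul_eq_C_mul, map_smul,
    hk k (by simp at hk'; omega), smul_zero]

theorem lin_expand (p q : ℚ) (w1 w2 : ℕ) :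
    ((C p * X 0 + C q) ^ w1 * (C p * X 1 + C q) ^ w2 : MvPolynomial (Fin 2) ℚ) =
    ∑ i ∈ Finset.range (w1 + 1), ∑ j ∈ Finset.range (w2 + 1),
      (p ^ i * q ^ (w1 - i) * (w1.choose i : ℚ) * (p ^ j * q ^ (w2 - j) * (w2.choose j : ℚ))) •
        (X 0 ^ i * X 1 ^ j) := by
  rw [add_pow, add_pow, Finset.sum_mul_sum]
  refine Finset.sum_congr rfl fun i _ => Finset.sum_congr rfl fun j _ => ?_
  simp only [MvPolynomial.smul_eq_C_mul, C_mul, C_pow, map_natCast]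
  ring

theorem sig_lin (w1 w2 : ℕ) (p q : ℚ) :
    sigL w1 w2 ((Polynomial.C p * Polynomial.X + Polynomial.C q) ^ (w1 + w2)) =
      (C p * X 0 + C q) ^ w1 * (C p * X 1 + C q) ^ w2 := by
  rw [lin_expand]
  rw [sigL_apply]
  refine Finset.sum_congr rfl fun i hi => Finset.sum_congr rfl fun j hj => ?_
  simp only [Finset.mem_range] at hi hj
  rw [coeff_lin, MvPolynomial.smul_eq_C_mul, ← mul_assoc, ← C_mul]
  congr 2
  have : ((w1 + w2).choose (i + j) : ℚ) ≠ 0 := by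
    exact_mod_cast (Nat.choose_pos (by omega)).ne'
  rw [show w1 + w2 - (i + j) = (w1 - i) + (w2 - j) by omega]
  field_simp
  ring

theorem act1_lin (n : ℕ) (γ : SL2Z) (α : ℚ) :
    polyAct1 n γ ((Polynomial.C α * Polynomial.X + Polynomial.C 1) ^ n) =
    (Polynomial.C (α * ((γ.1 1 1 : ℤ) : ℚ) - ((γ.1 1 0 : ℤ) : ℚ)) * Polynomial.X +
      Polynomial.C (((γ.1 0 0 : ℤ) : ℚ) - α * ((γ.1 0 1 : ℤ) : ℚ))) ^ n := by
  have : (Polynomial.C (α * ((γ.1 1 1 : ℤ) : ℚ) - ((γ.1 1 0 : ℤ) : ℚ)) * Polynomial.X +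
      Polynomial.C (((γ.1 0 0 : ℤ) : ℚ) - α * ((γ.1 0 1 : ℤ) : ℚ))) =
      Polynomial.C α * (Polynomial.C ((γ.1 1 1 : ℤ) : ℚ) * Polynomial.X -
        Polynomial.C ((γ.1 0 1 : ℤ) : ℚ)) + (Polynomial.C (-((γ.1 1 0 : ℤ) : ℚ)) * Polynomial.X
        + Polynomial.C ((γ.1 0 0 : ℤ) : ℚ)) := by
    simp only [Polynomial.C_sub, Polynomial.C_mul, Polynomial.C_neg]; ring
  unfold polyAct1
  simp only [coeff_lin]
  rw [this, add_pow]
  refine Finset.sum_congr rfl fun m _ => ?_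
  simp only [mul_pow, one_pow, Polynomial.C_mul, Polynomial.C_pow, map_natCast, Polynomial.C_1]
  ring

theorem act2_lin (w1 w2 : ℕ) (γ : SL2Z) (α : ℚ) :
    polyAct2 w1 w2 γ γ ((C α * X 0 + C 1) ^ w1 * (C α * X 1 + C 1) ^ w2) =
    (C (α * ((γ.1 1 1 : ℤ) : ℚ) - ((γ.1 1 0 : ℤ) : ℚ)) * X 0 +
      C (((γ.1 0 0 : ℤ) : ℚ) - α * ((γ.1 0 1 : ℤ) : ℚ))) ^ w1 *
    (C (α * ((γ.1 1 1 : ℤ) : ℚ) - ((γ.1 1 0 : ℤ) : ℚ)) * X 1 +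
      C (((γ.1 0 0 : ℤ) : ℚ) - α * ((γ.1 0 1 : ℤ) : ℚ))) ^ w2 := by
  have key : ∀ x : MvPolynomial (Fin 2) ℚ, (C (α * ((γ.1 1 1 : ℤ) : ℚ) - ((γ.1 1 0 : ℤ) : ℚ)) * x +
      C (((γ.1 0 0 : ℤ) : ℚ) - α * ((γ.1 0 1 : ℤ) : ℚ))) =
      C α * (C ((γ.1 1 1 : ℤ) : ℚ) * x - C ((γ.1 0 1 : ℤ) : ℚ)) +
        (C (-((γ.1 1 0 : ℤ) : ℚ)) * x + C ((γ.1 0 0 : ℤ) : ℚ)) := by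
    intro x
    simp only [C_sub, C_mul, C_neg]; ring
  rw [key, key, lin_expand, add_pow, add_pow, Finset.sum_mul_sum, ← act2L_apply, map_sum]
  refine Finset.sum_congr rfl fun i hi => ?_
  rw [map_sum]
  refine Finset.sum_congr rfl fun j hj => ?_
  simp only [Finset.mem_range] at hi hj
  rw [map_smul, act2L_apply, act2_mono _ _ _ _ _ _ (by omega) (by omega)]
  simp only [mfrac, mul_pow, one_pow, MvPolynomial.smul_eq_C_mul, C_mul, C_pow, map_natCast, C_1]
  ring

theorem sig_act (w1 w2 : ℕ) (γ : SL2Z) (Q : Polynomial ℚ) (hQ : Q.natDegree ≤ w1 + w2) :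
    polyAct2 w1 w2 γ γ (sigL w1 w2 Q) = sigL w1 w2 (polyAct1 (w1 + w2) γ Q) := by
  refine ext1 (w1 + w2) ((act2L w1 w2 γ γ).comp (sigL w1 w2))
    ((sigL w1 w2).comp (act1L (w1 + w2) γ)) ?_ Q hQ
  intro α
  rw [LinearMap.comp_apply, LinearMap.comp_apply, sig_lin]
  change polyAct2 w1 w2 γ γ _ = sigL w1 w2 (polyAct1 _ _ _)
  rw [act1_lin, sig_lin, act2_lin]

theorem diag_sig (w1 w2 : ℕ) (Q : Polynomial ℚ) (hQ : Q.natDegree ≤ w1 + w2) :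
    diagEval (sigL w1 w2 Q) = Q := by
  refine ext1 (w1 + w2) (diagL.comp (sigL w1 w2)) LinearMap.id ?_ Q hQ
  intro α
  rw [LinearMap.comp_apply, sig_lin, LinearMap.id_apply]
  simp only [diagL, AlgHom.toLinearMap_apply, map_mul, map_pow, map_add, aeval_X,
    MvPolynomial.algHom_C, Polynomial.algebraMap_eq]
  ring

theorem sig_mem (w1 w2 : ℕ) (Q : Polynomial ℚ) : MemV2 w1 w2 (sigL w1 w2 Q) := by
  constructor
  all_goals
    rw [sigL_apply]
    refine (degreeOf_sum_le _ _ _).trans (Finset.sup_le fun i hi => ?_)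
    refine (degreeOf_sum_le _ _ _).trans (Finset.sup_le fun j hj => ?_)
    simp only [Finset.mem_range] at hi hj
    refine (degreeOf_C_mul_le _ _ _).trans ((degreeOf_C_mul_le _ _ _).trans ?_)
    rw [mono_eq]
    refine degreeOf_le_iff.2 fun m hm => ?_
    have := Finset.mem_singleton.1 (support_monomial_subset hm)
    subst this
    simp
    omega

/-- Exactness of `0 → V_{w1-1,w2-1}^ℚ[I_D] → V_{w1,w2}^ℚ[I_D] → W_{w1+w2}^ℚ → 0`, where the
first map is `μ : P ↦ (X1-X2)·P` and the second is diagonal evaluation `ψ : P ↦ P(Z,Z)`. -/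
theorem exact_sequence_VID (w1 w2 : ℕ) (hw1 : Even w1) (hw2 : Even w2)
    (hw1' : 2 ≤ w1) (hw2' : 2 ≤ w2) :
    -- μ is well defined
    (∀ P : MvPolynomial (Fin 2) ℚ, MemVID (w1 - 1) (w2 - 1) P → MemVID w1 w2 (mulDiag P)) ∧
    -- μ is injective
    (∀ P P' : MvPolynomial (Fin 2) ℚ, mulDiag P = mulDiag P' → P = P') ∧
    -- ψ is well defined
    (∀ P : MvPolynomial (Fin 2) ℚ, MemVID w1 w2 P → MemW1 (w1 + w2) (diagEval P)) ∧
    -- image of μ = kernel of ψ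
    (∀ P : MvPolynomial (Fin 2) ℚ, MemVID w1 w2 P →
      (diagEval P = 0 ↔ ∃ P0 : MvPolynomial (Fin 2) ℚ,
        MemVID (w1 - 1) (w2 - 1) P0 ∧ P = mulDiag P0)) ∧
    -- ψ is surjective onto W_{w1+w2}^ℚ
    (∀ P' : Polynomial ℚ, MemW1 (w1 + w2) P' →
      ∃ P : MvPolynomial (Fin 2) ℚ, MemVID w1 w2 P ∧ diagEval P = P') := by
  obtain ⟨a, rfl⟩ : ∃ a, w1 = a + 1 := ⟨w1 - 1, by omega⟩
  obtain ⟨b, rfl⟩ : ∃ b, w2 = b + 1 := ⟨w2 - 1, by omega⟩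
  simp only [Nat.add_sub_cancel]
  refine ⟨fun P hP => (memVID_mul a b P).2 hP, mulDiag_inj, ?_, ?_, ?_⟩
  · rintro P ⟨h0, h1, h2⟩
    refine ⟨diag_deg _ _ P h0, ?_, ?_⟩
    · rw [← diag_act _ _ _ P h0]
      unfold diagEval
      rw [← map_add, h1, map_zero]
    · rw [← diag_act _ _ _ P h0, ← diag_act _ _ _ P h0]
      unfold diagEval
      rw [← map_add, ← map_add, h2, map_zero]
  · intro P hP
    constructor
    · intro h
      obtain ⟨P0, rfl⟩ := diag_ker P h
      exact ⟨P0, (memVID_mul a b P0).1 hP, rfl⟩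
    · rintro ⟨P0, _, rfl⟩
      exact diag_mul P0
  · rintro Q ⟨h0, h1, h2⟩
    have h0' : Q.natDegree ≤ (a + 1) + (b + 1) := h0
    refine ⟨sigL (a + 1) (b + 1) Q, ⟨sig_mem _ _ _, ?_, ?_⟩, diag_sig _ _ Q h0'⟩
    · rw [sig_act _ _ _ Q h0', ← map_add, h1, map_zero]
    · rw [sig_act _ _ _ Q h0', sig_act _ _ _ Q h0', ← map_add, ← map_add, h2, map_zero]
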